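/- arXiv:1208.5220 — 6 statements merged into one kernel-verified Lean document; each statement's English description precedes it below -/
import Mathlib

section
/- Let A, G₁, G₂ be groups and φ₁ : A → G₁, φ₂ : A → G₂ injective group homomorphisms whose images are contained in the centers of G₁ and G₂ respectively. Let G = G₁ ∗_A G₂ be the amalgamated free product (the pushout of φ₁ and φ₂), with canonical maps ι₁ : G₁ → G and ι₂ : G₂ → G. Let B be a subgroup of A. If the image of B in G is a virtual direct factor of G, then for each i ∈ {1,2} the subgroup φᵢ(B) is a virtual direct factor of Gᵢ. -/
/-- A subgroup `B` of a group `G` is a virtual direct factor of `G` if there is a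
finite-index subgroup `K₀` of `G` containing `B` and a normal subgroup `L` of `K₀`
such that `K₀ = B · L` and `B ∩ L = {1}`. -/
def IsVirtualDirectFactor {G : Type*} [Group G] (B : Subgroup G) : Prop :=
  ∃ K₀ : Subgroup G, K₀.FiniteIndex ∧ B ≤ K₀ ∧
    ∃ L : Subgroup G, L ≤ K₀ ∧
      (∀ k ∈ K₀, ∀ l ∈ L, k * l * k⁻¹ ∈ L) ∧
      (∀ x ∈ K₀, ∃ b ∈ B, ∃ l ∈ L, x = b * l) ∧
      B ⊓ L = ⊥

/-- A subgroup is a virtual direct factor if its image under an injective homomorphism is one. -/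
theorem IsVirtualDirectFactor.of_map_injective {G H : Type*} [Group G] [Group H] {f : G →* H}
    (hf : Function.Injective f) {B : Subgroup G} (h : IsVirtualDirectFactor (B.map f)) :
    IsVirtualDirectFactor B := by
  obtain ⟨K, hK, hBK, L, hLK, hnorm, hprod, hdisj⟩ := h
  refine ⟨K.comap f, ⟨fun h ↦ hK.index_ne_zero
    (K.index_eq_zero_of_relIndex_eq_zero ((K.index_comap f).symm.trans h))⟩,
    Subgroup.map_le_iff_le_comap.mp hBK, L.comap f,
    Subgroup.comap_mono hLK, fun k hk l hl ↦ ?_, fun x hx ↦ ?_, ?_⟩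
  · simpa using hnorm (f k) hk (f l) hl
  · obtain ⟨_, ⟨b, hb, rfl⟩, l, hl, hx⟩ := hprod (f x) hx
    exact ⟨b, hb, b⁻¹ * x, by simpa [hx] using hl, by simp⟩
  · refine (Subgroup.eq_bot_iff_forall _).mpr fun x hx ↦ hf ?_
    have hfx : f x ∈ B.map f ⊓ L := ⟨Subgroup.mem_map_of_mem f hx.1, hx.2⟩
    rw [hdisj, Subgroup.mem_bot] at hfx
    rw [hfx, map_one]

/-- Let `G = G₁ ∗_A G₂` be the amalgamated free product of two groups along central,
injectively embedded subgroups isomorphic to `A`. If `B ≤ A` has image in `G` that is a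
virtual direct factor of `G`, then the image of `B` in each `Gᵢ` is a virtual direct
factor of `Gᵢ`. (The two factors are indexed by `Bool`.) -/
theorem virtual_direct_factor_of_amalgam
    {A : Type*} [Group A] {G : Bool → Type*} [∀ i, Group (G i)]
    (φ : ∀ i, A →* G i)
    (hinj : ∀ i, Function.Injective (φ i))
    (hcent : ∀ i, (φ i).range ≤ Subgroup.center (G i))
    (B : Subgroup A)
    (h : IsVirtualDirectFactor (B.map (Monoid.PushoutI.base φ))) :
    ∀ i, IsVirtualDirectFactor (B.map (φ i)) := by
  intro i
  apply IsVirtualDirectFactor.of_map_injective (Monoid.PushoutI.of_injective hinj i)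
  rwa [Subgroup.map_map, Monoid.PushoutI.of_comp_eq_base]
end

section
/- Let n ≥ 2 and let Γ be a finite-index subgroup of GL_n(ℤ). Then the subgroup of ℤ^n generated by the set {v − g·v : v ∈ ℤ^n, g ∈ Γ} has finite index in ℤ^n; equivalently, the group of coinvariants (ℤ^n)_Γ is finite. -/
open Matrix

/-- The transvection `1 + c E_{ij}`, with `i ≠ j`, as an element of the general linear group,
multiplicative in `c`. -/
def transvectionGL {ι R : Type*} [Fintype ι] [DecidableEq ι] [CommRing R] {i j : ι} (h : i ≠ j) :
    Multiplicative R →* GL ι R where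
  toFun c :=
    ⟨transvection i j c.toAdd, transvection i j (-c.toAdd),
      by rw [transvection_mul_transvection_same i j h, add_neg_cancel, transvection_zero],
      by rw [transvection_mul_transvection_same i j h, neg_add_cancel, transvection_zero]⟩
  map_one' := Units.ext (transvection_zero i j)
  map_mul' c d := Units.ext (transvection_mul_transvection_same i j h c.toAdd d.toAdd).symm

theorem coe_transvectionGL {ι R : Type*} [Fintype ι] [DecidableEq ι] [CommRing R] {i j : ι}
    (h : i ≠ j) (c : Multiplicative R) :
    (transvectionGL h c : Matrix ι ι R) = transvection i j c.toAdd :=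
  rfl

theorem transvection_mulVec_single {ι R : Type*} [Fintype ι] [DecidableEq ι] [CommRing R]
    (i j : ι) (c x : R) :
    transvection i j c *ᵥ Pi.single j x = Pi.single j x + Pi.single i (c * x) := by
  rw [transvection, add_mulVec, one_mulVec, single_mulVec]
  simp [Pi.single]

/-- If `Γ` is a finite-index subgroup of `GL_n(ℤ)` with `n ≥ 2`, then the subgroup of
`ℤ^n` generated by `{v - g·v : v ∈ ℤ^n, g ∈ Γ}` has finite index in `ℤ^n`;
equivalently, the group of coinvariants `(ℤ^n)_Γ` is finite. -/
theorem coinvariants_finite_of_finiteIndex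
    {n : ℕ} (hn : 2 ≤ n) (Γ : Subgroup (GL (Fin n) ℤ)) (hΓ : Γ.FiniteIndex) :
    (AddSubgroup.closure {w : Fin n → ℤ | ∃ (v : Fin n → ℤ) (g : GL (Fin n) ℤ),
        g ∈ Γ ∧ w = v - (g : Matrix (Fin n) (Fin n) ℤ).mulVec v}).FiniteIndex := by
  have : Nontrivial (Fin n) := Fin.nontrivial_iff_two_le.mpr hn
  have := AddSubgroup.finiteIndex_range_nsmulAddMonoidHom_of_fg (Fin n → ℤ)
    (Nat.factorial_ne_zero Γ.index)
  refine AddSubgroup.finiteIndex_of_le (H := (nsmulAddMonoidHom Γ.index.factorial).range) ?_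
  rintro _ ⟨v, rfl⟩
  rw [nsmulAddMonoidHom_apply, ← Finset.univ_sum_single (Γ.index.factorial • v)]
  refine AddSubgroup.sum_mem _ fun i _ => AddSubgroup.subset_closure ?_
  obtain ⟨j, hj⟩ := exists_ne i
  obtain ⟨m, hm0, hm, hmem⟩ := Subgroup.exists_pow_mem_of_index_ne_zero hΓ.index_ne_zero
    (transvectionGL hj.symm (Multiplicative.ofAdd (1 : ℤ)))
  obtain ⟨k, hk⟩ := Nat.dvd_factorial hm0 hm
  refine ⟨Pi.single j (-(k * v i)), _, hmem, ?_⟩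
  rw [← map_pow, coe_transvectionGL, transvection_mulVec_single, sub_add_cancel_left,
    ← Pi.single_neg, hk]
  congr 1
  simp [mul_assoc]
end

section
/- Let n ≥ 2, let K be a group, and let φ : K → GL_n(ℤ) = Aut(ℤ^n) be a group homomorphism whose image φ(K) has finite index in GL_n(ℤ). If the abelianization of K is finite, then the abelianization of the semidirect product G = ℤ^n ⋊_φ K is finite. -/
open Matrix

/-- The multiplicative automorphism of `ℤ^n` (written multiplicatively) induced by a
matrix `g ∈ GL_n(ℤ)` acting by matrix-vector multiplication. -/
def glAut {n : ℕ} (g : GL (Fin n) ℤ) :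
    Multiplicative (Fin n → ℤ) ≃* Multiplicative (Fin n → ℤ) where
  toFun v := Multiplicative.ofAdd ((g : Matrix (Fin n) (Fin n) ℤ).mulVec v.toAdd)
  invFun v := Multiplicative.ofAdd
    (((g⁻¹ : GL (Fin n) ℤ) : Matrix (Fin n) (Fin n) ℤ).mulVec v.toAdd)
  left_inv v := by
    simp [Matrix.mulVec_mulVec]
  right_inv v := by
    simp [Matrix.mulVec_mulVec]
  map_mul' v w := by
    simp [Matrix.mulVec_add, ofAdd_add]

/-- The homomorphism `GL_n(ℤ) → Aut(ℤ^n)` given by the standard action. -/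
def glHom (n : ℕ) : GL (Fin n) ℤ →* MulAut (Multiplicative (Fin n → ℤ)) where
  toFun := glAut
  map_one' := by
    ext v
    simp [glAut]
  map_mul' g h := by
    ext v
    simp [glAut, Matrix.mulVec_mulVec]

/-- The elementary matrix `1 + E i j` as an element of `GL_n(ℤ)`. -/
def glTransvection {n : ℕ} {i j : Fin n} (h : i ≠ j) : GL (Fin n) ℤ where
  val := transvection i j 1
  inv := transvection i j (-1)
  val_inv := by simp [transvection_mul_transvection_same _ _ h]
  inv_val := by simp [transvection_mul_transvection_same _ _ h]

theorem coe_glTransvection_pow {n : ℕ} {i j : Fin n} (h : i ≠ j) (m : ℕ) :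
    ((glTransvection h ^ m : GL (Fin n) ℤ) : Matrix (Fin n) (Fin n) ℤ) =
      transvection i j (m : ℤ) := by
  induction m with
  | zero => simp
  | succ m ih =>
    rw [pow_succ, Units.val_mul, ih]
    change transvection i j (m : ℤ) * transvection i j 1 = _
    rw [transvection_mul_transvection_same _ _ h]
    push_cast
    rfl

theorem glTransvection_pow_mulVec_single {n : ℕ} {i j : Fin n} (h : i ≠ j) (m : ℕ) :
    ((glTransvection h ^ m : GL (Fin n) ℤ) : Matrix (Fin n) (Fin n) ℤ).mulVec
      (Pi.single j 1) = m • Pi.single i 1 + Pi.single j 1 := by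
  rw [coe_glTransvection_pow, transvection, add_mulVec, one_mulVec, add_comm]
  congr 1
  ext k
  simp [Matrix.single_apply, Pi.single_apply, eq_comm]

theorem MonoidHom.finite_range_of_finite_abelianization {G A : Type*} [Group G] [CommGroup A]
    [Finite (Abelianization G)] (f : G →* A) : Finite f.range := by
  refine Set.Finite.subset (Set.finite_range (Abelianization.lift f)) ?_
  rintro _ ⟨x, rfl⟩
  exact ⟨Abelianization.of x, Abelianization.lift_apply_of f x⟩

/-- A homomorphism from `ℤ^n` to a commutative group that is invariant under a finite-index
subgroup of `GL_n(ℤ)` has finite range, provided `n ≥ 2`. -/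
theorem finite_range_of_invariant {n : ℕ} (hn : 2 ≤ n) {A : Type*} [CommGroup A]
    (H : Subgroup (GL (Fin n) ℤ)) [H.FiniteIndex] (f : Multiplicative (Fin n → ℤ) →* A)
    (hf : ∀ g ∈ H, ∀ v, f (glHom n g v) = f v) : Finite f.range := by
  have key (i : Fin n) : ∃ m : ℕ, 0 < m ∧ f (.ofAdd (Pi.single i 1)) ^ m = 1 := by
    have : Nontrivial (Fin n) := Fin.nontrivial_iff_two_le.2 hn
    obtain ⟨j, hj⟩ := exists_ne i
    obtain ⟨m, hm, -, hmem⟩ :=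
      Subgroup.exists_pow_mem_of_index_ne_zero H.index_ne_zero_of_finite (glTransvection hj.symm)
    refine ⟨m, hm, ?_⟩
    have hinv := hf _ hmem (.ofAdd (Pi.single j 1))
    change f (.ofAdd (Matrix.mulVec _ (Pi.single j 1))) = _ at hinv
    rwa [glTransvection_pow_mulVec_single, ofAdd_add, map_mul, ofAdd_nsmul, map_pow,
      mul_eq_right] at hinv
  have htors (v : Multiplicative (Fin n → ℤ)) : f v ∈ CommGroup.torsion A := by
    have hv : v = ∏ i, Multiplicative.ofAdd (Pi.single i 1) ^ v.toAdd i := by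
      apply Multiplicative.toAdd.injective
      ext k
      simp [Finset.sum_apply, Pi.single_apply]
    rw [hv, map_prod]
    refine Subgroup.prod_mem _ fun i _ => ?_
    rw [map_zpow]
    exact Subgroup.zpow_mem _ (isOfFinOrder_iff_pow_eq_one.2 (key i)) _
  have : Group.FG f.range := Group.fg_range f
  refine CommGroup.finite_of_fg_isMulTorsion f.range ?_
  rintro ⟨_, v, rfl⟩
  exact Submonoid.isOfFinOrder_coe.1 (htors v)

/-- Let `n ≥ 2` and `φ : K → GL_n(ℤ) = Aut(ℤ^n)` be a homomorphism whose image has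
finite index in `GL_n(ℤ)`. If the abelianization of `K` is finite, then the
abelianization of the semidirect product `ℤ^n ⋊_φ K` is finite. -/
theorem abelianization_semidirect_finite
    {n : ℕ} (hn : 2 ≤ n) {K : Type*} [Group K] (φ : K →* GL (Fin n) ℤ)
    (hrange : φ.range.FiniteIndex)
    (hK : Finite (Abelianization K)) :
    Finite (Abelianization
      (SemidirectProduct (Multiplicative (Fin n → ℤ)) K ((glHom n).comp φ))) := by
  let ψ := (glHom n).comp φ
  let f : Multiplicative (Fin n → ℤ) →*
      Abelianization (SemidirectProduct (Multiplicative (Fin n → ℤ)) K ψ) :=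
    Abelianization.of.comp SemidirectProduct.inl
  let g : K →* Abelianization (SemidirectProduct (Multiplicative (Fin n → ℤ)) K ψ) :=
    Abelianization.of.comp SemidirectProduct.inr
  have hf : Finite f.range := by
    refine finite_range_of_invariant hn φ.range f ?_
    rintro _ ⟨k, rfl⟩ v
    change Abelianization.of (SemidirectProduct.inl (ψ k v)) = _
    rw [SemidirectProduct.inl_aut, map_mul, map_mul, mul_right_comm, ← map_mul, ← map_mul]
    simp [f]
  have hg : Finite g.range := g.finite_range_of_finite_abelianization
  refine Finite.of_surjective (fun p : f.range × g.range => p.1.1 * p.2.1) ?_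
  intro a
  obtain ⟨x, rfl⟩ := QuotientGroup.mk_surjective a
  refine ⟨(⟨f x.left, x.left, rfl⟩, ⟨g x.right, x.right, rfl⟩), ?_⟩
  change Abelianization.of _ * Abelianization.of _ = Abelianization.of x
  rw [← map_mul, SemidirectProduct.inl_left_mul_inr_right]
end

section
/- Let A and B be groups and φ : B → Aut(A) a group homomorphism. Then the abelianization of the semidirect product A ⋊_φ B is isomorphic to (A^{ab})_B × B^{ab}, where (A^{ab})_B denotes the quotient of the abelianization A^{ab} by the subgroup generated by all elements of the form [a]·[φ(b)(a)]⁻¹ with a ∈ A, b ∈ B (here [a] denotes the image of a in A^{ab}). -/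
/-- The subgroup of `Abelianization A` generated by the elements
`[a]·[φ(b)(a)]⁻¹` for `a ∈ A`, `b ∈ B`; the quotient by it is the group of
coinvariants `(A^{ab})_B`. -/
def coinvariantsSubgroup {A B : Type*} [Group A] [Group B] (φ : B →* MulAut A) :
    Subgroup (Abelianization A) :=
  Subgroup.closure
    {x | ∃ (a : A) (b : B), x = Abelianization.of a * (Abelianization.of (φ b a))⁻¹}

instance {A B : Type*} [Group A] [Group B] (φ : B →* MulAut A) :
    (coinvariantsSubgroup φ).Normal :=
  Subgroup.normal_of_comm _

/-- A homomorphism from `Abelianization A` to a commutative group kills the coinvariants subgroup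
as soon as it does not distinguish the classes of `a` and `φ b a`. -/
theorem coinvariantsSubgroup_le_ker {A B M : Type*} [Group A] [Group B] [Group M]
    {φ : B →* MulAut A} (f : Abelianization A →* M)
    (hf : ∀ a b, f (Abelianization.of (φ b a)) = f (Abelianization.of a)) :
    coinvariantsSubgroup φ ≤ f.ker := by
  rw [coinvariantsSubgroup, Subgroup.closure_le]
  rintro _ ⟨a, b, rfl⟩
  simp [MonoidHom.mem_ker, hf]

theorem mk_of_apply_eq_mk_of {A B : Type*} [Group A] [Group B] (φ : B →* MulAut A)
    (a : A) (b : B) :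
    QuotientGroup.mk' (coinvariantsSubgroup φ) (Abelianization.of (φ b a)) =
      QuotientGroup.mk' (coinvariantsSubgroup φ) (Abelianization.of a) :=
  QuotientGroup.eq.2 (Subgroup.subset_closure ⟨a, b, mul_comm _ _⟩)

namespace SemidirectProduct

variable {A B : Type*} [Group A] [Group B] (φ : B →* MulAut A)

/-- The homomorphism from the abelianization of `A ⋊[φ] B` to `(A^{ab})_B × B^{ab}`. -/
def abelianizationToProd : Abelianization (A ⋊[φ] B) →*
    (Abelianization A ⧸ coinvariantsSubgroup φ) × Abelianization B :=
  Abelianization.lift <| SemidirectProduct.lift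
    ((MonoidHom.inl _ _).comp
      ((QuotientGroup.mk' (coinvariantsSubgroup φ)).comp Abelianization.of))
    ((MonoidHom.inr _ _).comp Abelianization.of) fun b => by
      ext a
      · simpa using mk_of_apply_eq_mk_of φ a b
      · simp

/-- The homomorphism from `(A^{ab})_B × B^{ab}` to the abelianization of `A ⋊[φ] B`. -/
def prodToAbelianization : (Abelianization A ⧸ coinvariantsSubgroup φ) × Abelianization B →*
    Abelianization (A ⋊[φ] B) :=
  MonoidHom.coprod
    (QuotientGroup.lift _ (Abelianization.map inl) <| coinvariantsSubgroup_le_ker _ fun a b => by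
      rw [Abelianization.map_of, Abelianization.map_of, inl_aut, map_mul, map_mul, map_inv, map_inv,
        mul_inv_cancel_comm])
    (Abelianization.map inr)

theorem prodToAbelianization_comp_abelianizationToProd :
    (prodToAbelianization φ).comp (abelianizationToProd φ) = MonoidHom.id _ := by
  refine Abelianization.hom_ext _ _ (hom_ext ?_ ?_) <;> ext <;>
    simp [prodToAbelianization, abelianizationToProd]

theorem abelianizationToProd_comp_prodToAbelianization :
    (abelianizationToProd φ).comp (prodToAbelianization φ) = MonoidHom.id _ := by
  refine MonoidHom.ext ?_
  rintro ⟨⟨⟨a⟩⟩, ⟨b⟩⟩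
  change abelianizationToProd φ (prodToAbelianization φ
    (QuotientGroup.mk (Abelianization.of a), Abelianization.of b)) =
      (QuotientGroup.mk (Abelianization.of a), Abelianization.of b)
  simp [prodToAbelianization, abelianizationToProd]

end SemidirectProduct

/-- The abelianization of a semidirect product `A ⋊_φ B` is isomorphic to
`(A^{ab})_B × B^{ab}`, where `(A^{ab})_B` is the group of coinvariants for the
induced action of `B` on the abelianization of `A`. -/
theorem abelianization_semidirectProduct_iso
    {A B : Type*} [Group A] [Group B] (φ : B →* MulAut A) :
    Nonempty (Abelianization (SemidirectProduct A B φ) ≃*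
      (Abelianization A ⧸ coinvariantsSubgroup φ) × Abelianization B) :=
  ⟨MonoidHom.toMulEquiv (SemidirectProduct.abelianizationToProd φ)
    (SemidirectProduct.prodToAbelianization φ)
    (SemidirectProduct.prodToAbelianization_comp_abelianizationToProd φ)
    (SemidirectProduct.abelianizationToProd_comp_prodToAbelianization φ)⟩
end

section
/- Let G be a group and N a normal subgroup of G. If both N and the quotient G/N have finite abelianization, then G has finite abelianization. -/
/-- If a normal subgroup `N` of `G` and the quotient `G/N` both have finite
abelianization, then `G` has finite abelianization. -/
theorem abelianization_finite_of_normal_of_quotient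
    {G : Type*} [Group G] (N : Subgroup G) [N.Normal]
    (hN : Finite (Abelianization N)) (hQ : Finite (Abelianization (G ⧸ N))) :
    Finite (Abelianization G) := by
  let H : Subgroup (Abelianization G) := (Abelianization.map N.subtype).range
  have : Finite H :=
    Finite.of_surjective _ (Abelianization.map N.subtype).rangeRestrict_surjective
  let f : G →* Abelianization G ⧸ H := (QuotientGroup.mk' H).comp Abelianization.of
  have hf : N ≤ f.ker := fun n hn ↦
    (QuotientGroup.eq_one_iff _).2 ⟨Abelianization.of ⟨n, hn⟩, Abelianization.map_of _ _⟩
  have : Finite (Abelianization G ⧸ H) := by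
    refine Finite.of_surjective (Abelianization.lift (QuotientGroup.lift N f hf)) fun x ↦ ?_
    obtain ⟨x, rfl⟩ := QuotientGroup.mk_surjective x
    obtain ⟨g, rfl⟩ := QuotientGroup.mk_surjective x
    exact ⟨Abelianization.of (g : G ⧸ N), rfl⟩
  exact Finite.of_subgroup_quotient H
end

section
/- Let Q ∈ SL₂(ℤ) be a matrix with |trace(Q)| > 2, and let φ : ℤ → Aut(ℤ²) be the homomorphism sending m to the automorphism given by Q^m. Then the semidirect product ℤ² ⋊_φ ℤ is not virtually nilpotent: it contains no nilpotent subgroup of finite index. -/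
open Matrix

/-- The Cayley-Hamilton recurrence for the traces of the powers of a `2 × 2` matrix of
determinant one. -/
theorem trace_pow_add_two {R : Type*} [CommRing R] (A : Matrix (Fin 2) (Fin 2) R)
    (hA : A.det = 1) (n : ℕ) :
    (A ^ (n + 2)).trace = A.trace * (A ^ (n + 1)).trace - (A ^ n).trace := by
  have hsq : A * A = A.trace • A - 1 := by
    rw [det_fin_two] at hA
    ext i j
    fin_cases i <;> fin_cases j <;>
      simp [mul_apply, Fin.sum_univ_two, trace_fin_two] <;> grind
  rw [pow_add, pow_two, hsq, mul_sub, mul_smul_comm, mul_one, ← pow_succ, trace_sub, trace_smul,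
    smul_eq_mul]

theorem abs_trace_pow_lt_abs_trace_pow_succ (A : Matrix (Fin 2) (Fin 2) ℤ) (hA : A.det = 1)
    (htr : 2 < |A.trace|) (n : ℕ) : |(A ^ n).trace| < |(A ^ (n + 1)).trace| := by
  induction n with
  | zero => simpa using htr
  | succ n ih =>
    rw [trace_pow_add_two A hA n]
    have hsub := abs_sub_abs_le_abs_sub (A.trace * (A ^ (n + 1)).trace) (A ^ n).trace
    rw [abs_mul] at hsub
    nlinarith [abs_nonneg (A ^ (n + 1)).trace]

theorem two_lt_abs_trace_pow (A : Matrix (Fin 2) (Fin 2) ℤ) (hA : A.det = 1)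
    (htr : 2 < |A.trace|) {n : ℕ} (hn : 0 < n) : 2 < |(A ^ n).trace| := by
  have hmono : StrictMono fun k ↦ |(A ^ k).trace| :=
    strictMono_nat_of_lt_succ (abs_trace_pow_lt_abs_trace_pow_succ A hA htr)
  simpa using hmono hn

theorem det_one_sub_fin_two {R : Type*} [CommRing R] (A : Matrix (Fin 2) (Fin 2) R) :
    (1 - A).det = 1 - A.trace + A.det := by
  simp [det_fin_two, trace_fin_two]
  ring

theorem det_one_sub_pow_ne_zero (A : Matrix (Fin 2) (Fin 2) ℤ) (hA : A.det = 1)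
    (htr : 2 < |A.trace|) {n : ℕ} (hn : 0 < n) : (1 - A ^ n).det ≠ 0 := by
  have htr' := two_lt_abs_trace_pow A hA htr hn
  rw [det_one_sub_fin_two, det_pow, hA, one_pow]
  intro h
  rw [show (A ^ n).trace = 2 by linarith] at htr'
  norm_num at htr'

/-- Iterated commutators of `inl x` with `inr g` are the iterates of `y ↦ y * (φ g y)⁻¹`. -/
theorem inl_iterate_mem_lowerCentralSeries {N G : Type*} [CommGroup N] [Group G]
    {φ : G →* MulAut N} {H : Subgroup (SemidirectProduct N G φ)} {x : N} {g : G}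
    (hx : SemidirectProduct.inl x ∈ H) (hg : SemidirectProduct.inr g ∈ H) (k : ℕ) :
    SemidirectProduct.inl ((fun y ↦ y * (φ g y)⁻¹)^[k] x) ∈ H.lowerCentralSeries k := by
  induction k with
  | zero => exact hx
  | succ k ih =>
    rw [Function.iterate_succ_apply', Subgroup.lowerCentralSeries_succ]
    convert Subgroup.commutator_mem_commutator ih hg using 1
    simp [commutatorElement_def, mul_assoc, SemidirectProduct.inl_aut]

theorem iterate_ofAdd_mulVec {n : ℕ} (g : GL (Fin n) ℤ) (v : Fin n → ℤ) (k : ℕ) :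
    (fun y ↦ y * (glHom n g y)⁻¹)^[k] (Multiplicative.ofAdd v) =
      Multiplicative.ofAdd ((1 - (g : Matrix (Fin n) (Fin n) ℤ)) ^ k *ᵥ v) := by
  induction k with
  | zero => simp
  | succ k ih =>
    rw [Function.iterate_succ_apply', ih, pow_succ', ← mulVec_mulVec, sub_mulVec, one_mulVec,
      ofAdd_sub, div_eq_mul_inv]
    rfl

/-- If `Q ∈ SL₂(ℤ)` has `|trace Q| > 2`, then the semidirect product `ℤ² ⋊_φ ℤ`,
where the generator of `ℤ` acts by `Q`, is not virtually nilpotent. (Both `ℤ²` and `ℤ`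
are written multiplicatively.) -/
theorem semidirect_sol_not_virtually_nilpotent
    (Q : Matrix.SpecialLinearGroup (Fin 2) ℤ)
    (hQ : 2 < |Matrix.trace (Q : Matrix (Fin 2) (Fin 2) ℤ)|) :
    ¬ ∃ H : Subgroup (SemidirectProduct (Multiplicative (Fin 2 → ℤ)) (Multiplicative ℤ)
        ((glHom 2).comp (zpowersHom (GL (Fin 2) ℤ) (Matrix.SpecialLinearGroup.toGL Q)))),
      H.FiniteIndex ∧ Group.IsNilpotent H := by
  rintro ⟨H, hfin, hnil⟩
  obtain ⟨n, hn, -, hnH⟩ := Subgroup.exists_pow_mem_of_index_ne_zero hfin.index_ne_zero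
    (SemidirectProduct.inr (Multiplicative.ofAdd 1))
  obtain ⟨m, hm, -, hmH⟩ := Subgroup.exists_pow_mem_of_index_ne_zero hfin.index_ne_zero
    (SemidirectProduct.inl (Multiplicative.ofAdd (Pi.single 0 1)))
  obtain ⟨k, hk⟩ := (Subgroup.isNilpotent_iff_lowerCentralSeries H).1 hnil
  rw [← map_pow, ← ofAdd_nsmul] at hnH hmH
  have hmem := inl_iterate_mem_lowerCentralSeries hmH hnH k
  rw [hk, Subgroup.mem_bot, ← map_one SemidirectProduct.inl, SemidirectProduct.inl_inj,
    MonoidHom.comp_apply, iterate_ofAdd_mulVec, ofAdd_eq_one] at hmem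
  have hcoe : ((zpowersHom (GL (Fin 2) ℤ) (Matrix.SpecialLinearGroup.toGL Q)
      (Multiplicative.ofAdd (n • (1 : ℤ))) : GL (Fin 2) ℤ) : Matrix (Fin 2) (Fin 2) ℤ) =
        (Q : Matrix (Fin 2) (Fin 2) ℤ) ^ n := by
    simp
  rw [hcoe] at hmem
  have hdet : ((1 - (Q : Matrix (Fin 2) (Fin 2) ℤ) ^ n) ^ k).det ≠ 0 := by
    rw [det_pow]
    exact pow_ne_zero k (det_one_sub_pow_ne_zero _ Q.2 hQ hn)
  have hzero := congrFun (eq_zero_of_mulVec_eq_zero hdet hmem) 0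
  simp at hzero
  omega
end
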